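/- arXiv:1811.01381 — 5 statements merged into one kernel-verified Lean document; each statement's English description precedes it below -/
import Mathlib

section
/- (Joint MAP/ML stationarity characterization.) A pair (H, F) ∈ ℂ^L × ℂ satisfies the stationarity system of the hybrid log-likelihood, namely (S₁/σₙ²)·(V₁ − H) + (S₂/σₙ²)·conj(F)·(V₂ − F·H) − C_H⁻¹·H = 0 and Hᴴ·(V₂ − F·H) = 0, if and only if H = A(F)·(V₁ + α·conj(F)·V₂) and g(F) = 0, where g(F) ≜ (V₁ + α·conj(F)·V₂)ᴴ · A(F)ᴴ·A(F) · (V₂ − F·V₁ + (σₙ²/S₁)·C_H⁻¹·V₂). -/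
open Matrix
open scoped ComplexOrder

theorem Matrix.PosDef.isUnit_det_smul_one_add_smul_inv {n : Type*} [Fintype n] [DecidableEq n]
    {C : Matrix n n ℂ} (hC : C.PosDef) {c k : ℂ} (hc : 0 < c) (hk : 0 < k) :
    IsUnit (c • (1 : Matrix n n ℂ) + k • C⁻¹).det :=
  (Matrix.isUnit_iff_isUnit_det _).mp
    ((Matrix.PosDef.one.smul hc).add (hC.inv.smul hk)).isUnit

theorem Matrix.eq_nonsing_inv_mulVec_iff {n R : Type*} [Fintype n] [DecidableEq n] [CommRing R]
    {M : Matrix n n R} (hM : IsUnit M.det) (x w : n → R) :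
    x = M⁻¹ *ᵥ w ↔ w - M *ᵥ x = 0 := by
  rw [sub_eq_zero]
  constructor
  · rintro rfl
    rw [mulVec_mulVec, mul_nonsing_inv _ hM, one_mulVec]
  · rintro rfl
    rw [mulVec_mulVec, nonsing_inv_mul _ hM, one_mulVec]

/-- Joint MAP/ML stationarity characterization.  A pair `(H, F)`
satisfies the stationarity system of the hybrid log-likelihood iff
`H = A(F)·(V₁ + α·conj(F)·V₂)` and `g(F) = 0`. -/
theorem joint_map_ml_stationarity (L : ℕ) (hL : 1 ≤ L) (V1 V2 : Fin L → ℂ)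
    (S1 S2 σn2 : ℝ) (hS1 : 0 < S1) (hS2 : 0 < S2) (hσn2 : 0 < σn2)
    (α : ℝ) (hα : α = S2 / S1)
    (CH : Matrix (Fin L) (Fin L) ℂ) (hCH : CH.PosDef)
    (A : ℂ → Matrix (Fin L) (Fin L) ℂ)
    (hA : ∀ F : ℂ, A F = ((1 + (α : ℂ) * (Complex.normSq F : ℂ)) • (1 : Matrix (Fin L) (Fin L) ℂ)
        + ((σn2 / S1 : ℝ) : ℂ) • CH⁻¹)⁻¹)
    (g : ℂ → ℂ)
    (hg : ∀ F : ℂ, g F = star (V1 + ((α : ℂ) * (starRingEnd ℂ) F) • V2) ⬝ᵥ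
        ((A F)ᴴ * A F).mulVec (V2 - F • V1 + ((σn2 / S1 : ℝ) : ℂ) • CH⁻¹.mulVec V2)) :
    ∀ (H : Fin L → ℂ) (F : ℂ),
      (((S1 / σn2 : ℝ) : ℂ) • (V1 - H)
            + (((S2 / σn2 : ℝ) : ℂ) * (starRingEnd ℂ) F) • (V2 - F • H)
            - CH⁻¹.mulVec H = 0
          ∧ star H ⬝ᵥ (V2 - F • H) = 0)
        ↔ (H = (A F).mulVec (V1 + ((α : ℂ) * (starRingEnd ℂ) F) • V2) ∧ g F = 0) := by
  intro H F
  set W := V1 + ((α : ℂ) * (starRingEnd ℂ) F) • V2 with hW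
  set k : ℂ := ((σn2 / S1 : ℝ) : ℂ) with hk
  set c : ℂ := 1 + (α : ℂ) * (Complex.normSq F : ℂ) with hc
  set M := c • (1 : Matrix (Fin L) (Fin L) ℂ) + k • CH⁻¹ with hM
  have hα0 : 0 < α := hα ▸ div_pos hS2 hS1
  have hk0 : 0 < k := by
    rw [hk]
    exact_mod_cast div_pos hσn2 hS1
  have hc0 : 0 < c := by
    have h : 0 < 1 + α * Complex.normSq F := by
      have := Complex.normSq_nonneg F
      positivity
    rw [hc]
    exact_mod_cast h
  have hdet : IsUnit M.det := hCH.isUnit_det_smul_one_add_smul_inv hc0 hk0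
  have hAM : A F * M = 1 := by rw [hA F, nonsing_inv_mul _ hdet]
  have hMv (x : Fin L → ℂ) : M *ᵥ x = c • x + k • CH⁻¹ *ᵥ x := by
    rw [hM, add_mulVec, smul_mulVec, smul_mulVec, one_mulVec]
  have hS1' : (S1 : ℂ) ≠ 0 := by exact_mod_cast hS1.ne'
  have hσ' : (σn2 : ℂ) ≠ 0 := by exact_mod_cast hσn2.ne'
  have hnormSq : (Complex.normSq F : ℂ) = (starRingEnd ℂ) F * F := Complex.normSq_eq_conj_mul_self
  have hgrad : ((S1 / σn2 : ℝ) : ℂ) • (V1 - H)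
      + (((S2 / σn2 : ℝ) : ℂ) * (starRingEnd ℂ) F) • (V2 - F • H) - CH⁻¹ *ᵥ H
      = ((S1 / σn2 : ℝ) : ℂ) • (W - M *ᵥ H) := by
    rw [hMv, hW, hc, hk, hα, hnormSq]
    ext i
    simp only [Pi.add_apply, Pi.sub_apply, Pi.smul_apply, smul_eq_mul]
    push_cast
    field_simp
    ring
  have hstat : ((S1 / σn2 : ℝ) : ℂ) • (V1 - H)
      + (((S2 / σn2 : ℝ) : ℂ) * (starRingEnd ℂ) F) • (V2 - F • H) - CH⁻¹ *ᵥ H = 0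
      ↔ H = A F *ᵥ W := by
    have hne : ((S1 / σn2 : ℝ) : ℂ) ≠ 0 := by exact_mod_cast (div_pos hS1 hσn2).ne'
    rw [hgrad, smul_eq_zero_iff_right hne, hA F, eq_nonsing_inv_mulVec_iff hdet]
  have hresid : V2 - F • V1 + k • CH⁻¹ *ᵥ V2 = M *ᵥ V2 - F • W := by
    rw [hMv, hW, hc, hnormSq]
    ext i
    simp only [Pi.add_apply, Pi.sub_apply, Pi.smul_apply, smul_eq_mul]
    ring
  have hgF : g F = star (A F *ᵥ W) ⬝ᵥ (V2 - F • A F *ᵥ W) := by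
    rw [hg F, hresid, ← mulVec_mulVec, mulVec_sub (A F), mulVec_mulVec _ (A F) M,
      hAM, one_mulVec, mulVec_smul, dotProduct_mulVec, star_mulVec]
  rw [hstat]
  refine and_congr_right fun hH => ?_
  rw [hgF, hH]
end

section
/- Suppose C_H = σ_H²·I with σ_H² > 0, and set u = σₙ²/(S₁·σ_H²) and c = S₁σ_H²/(S₁σ_H² + σₙ²). Then for every F ∈ ℂ, g(F) = (1+u)·(1 + α|F|² + u)⁻² · (V₁ + α·conj(F)·V₂)ᴴ·(V₂ − c·F·V₁). In particular, g(F) = 0 if and only if (V₁ + α·conj(F)·V₂)ᴴ·(V₂ − c·F·V₁) = 0. -/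
open Matrix
open scoped ComplexOrder

theorem Matrix.inv_smul_one {n K : Type*} [Fintype n] [DecidableEq n] [Field K] {a : K}
    (ha : a ≠ 0) : (a • (1 : Matrix n n K))⁻¹ = a⁻¹ • (1 : Matrix n n K) :=
  Matrix.inv_eq_right_inv (by simp [smul_smul, ha])

/-- When `C_H = σ_H²·I`, with `u = σₙ²/(S₁σ_H²)` and
`c = S₁σ_H²/(S₁σ_H² + σₙ²)`, the rational function `g` reduces to
`g(F) = (1+u)·(1 + α|F|² + u)⁻²·(V₁ + α·conj(F)·V₂)ᴴ·(V₂ − c·F·V₁)`;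
in particular `g(F) = 0` iff `(V₁ + α·conj(F)·V₂)ᴴ·(V₂ − c·F·V₁) = 0`. -/
theorem g_iid_channel (L : ℕ) (hL : 1 ≤ L) (V1 V2 : Fin L → ℂ)
    (S1 S2 σn2 σH2 : ℝ) (hS1 : 0 < S1) (hS2 : 0 < S2) (hσn2 : 0 < σn2) (hσH2 : 0 < σH2)
    (α : ℝ) (hα : α = S2 / S1)
    (u c : ℝ) (hu : u = σn2 / (S1 * σH2)) (hc : c = S1 * σH2 / (S1 * σH2 + σn2))
    (CH : Matrix (Fin L) (Fin L) ℂ) (hCH : CH = (σH2 : ℂ) • (1 : Matrix (Fin L) (Fin L) ℂ))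
    (A : ℂ → Matrix (Fin L) (Fin L) ℂ)
    (hA : ∀ F : ℂ, A F = ((1 + (α : ℂ) * (Complex.normSq F : ℂ)) • (1 : Matrix (Fin L) (Fin L) ℂ)
        + ((σn2 / S1 : ℝ) : ℂ) • CH⁻¹)⁻¹)
    (g : ℂ → ℂ)
    (hg : ∀ F : ℂ, g F = star (V1 + ((α : ℂ) * (starRingEnd ℂ) F) • V2) ⬝ᵥ
        ((A F)ᴴ * A F).mulVec (V2 - F • V1 + ((σn2 / S1 : ℝ) : ℂ) • CH⁻¹.mulVec V2)) :
    ∀ F : ℂ,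
      g F = ((1 + u : ℝ) : ℂ) * (((1 + α * Complex.normSq F + u : ℝ) : ℂ)⁻¹) ^ 2
            * (star (V1 + ((α : ℂ) * (starRingEnd ℂ) F) • V2) ⬝ᵥ (V2 - ((c : ℂ) * F) • V1))
        ∧ (g F = 0
            ↔ star (V1 + ((α : ℂ) * (starRingEnd ℂ) F) • V2) ⬝ᵥ (V2 - ((c : ℂ) * F) • V1) = 0) := by
  intro F
  have hu0 : 0 < u := hu ▸ by positivity
  have hα0 : 0 < α := hα ▸ by positivity
  have hnum : ((1 + u : ℝ) : ℂ) ≠ 0 := Complex.ofReal_ne_zero.mpr (by positivity)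
  have hd : ((1 + α * Complex.normSq F + u : ℝ) : ℂ) ≠ 0 :=
    Complex.ofReal_ne_zero.mpr (by have := Complex.normSq_nonneg F; positivity)
  have huc : (1 + u) * c = 1 := by
    rw [hu, hc]
    field_simp
  have hucC : ((1 + u : ℝ) : ℂ) * (c : ℂ) = 1 := by exact_mod_cast huc
  have hCinv : ((σn2 / S1 : ℝ) : ℂ) • CH⁻¹ = (u : ℂ) • (1 : Matrix (Fin L) (Fin L) ℂ) := by
    rw [hCH, Matrix.inv_smul_one (Complex.ofReal_ne_zero.mpr hσH2.ne'), smul_smul, hu]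
    congr 1
    push_cast
    rw [← div_eq_mul_inv, div_div]
  have hAF : A F = ((1 + α * Complex.normSq F + u : ℝ) : ℂ)⁻¹ •
      (1 : Matrix (Fin L) (Fin L) ℂ) := by
    rw [hA, hCinv, ← add_smul, ← Matrix.inv_smul_one hd]
    push_cast
    rfl
  have hvec : V2 - F • V1 + ((σn2 / S1 : ℝ) : ℂ) • CH⁻¹.mulVec V2 =
      ((1 + u : ℝ) : ℂ) • (V2 - ((c : ℂ) * F) • V1) := by
    rw [← Matrix.smul_mulVec, hCinv, Matrix.smul_mulVec, Matrix.one_mulVec, smul_sub, smul_smul,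
      ← mul_assoc, hucC, one_mul]
    push_cast
    module
  have key : g F = ((1 + u : ℝ) : ℂ) * (((1 + α * Complex.normSq F + u : ℝ) : ℂ)⁻¹) ^ 2
      * (star (V1 + ((α : ℂ) * (starRingEnd ℂ) F) • V2) ⬝ᵥ (V2 - ((c : ℂ) * F) • V1)) := by
    have hAA : (A F)ᴴ * A F = (((1 + α * Complex.normSq F + u : ℝ) : ℂ)⁻¹ ^ 2) •
        (1 : Matrix (Fin L) (Fin L) ℂ) := by
      rw [hAF, Matrix.conjTranspose_smul, Matrix.conjTranspose_one, star_inv₀,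
        ← starRingEnd_apply, Complex.conj_ofReal, Matrix.smul_mul, Matrix.one_mul, smul_smul, sq]
    rw [hg, hvec, hAA, Matrix.smul_mulVec, Matrix.one_mulVec, smul_smul, dotProduct_smul,
      smul_eq_mul]
    ring
  refine ⟨key, ?_⟩
  rw [key, mul_eq_zero_iff_left (mul_ne_zero hnum (pow_ne_zero 2 (inv_ne_zero hd)))]
end

section
/- (Single-packet case, L = 1.) Let V₁, V₂ ∈ ℂ with V₁ ≠ 0 and V₂ ≠ 0, let S₁, S₂, σₙ², σ_H² be positive reals, α = S₂/S₁, c = S₁σ_H²/(S₁σ_H² + σₙ²). Then the set of pairs (H, F) ∈ ℂ × ℂ satisfying the stationarity system (S₁/σₙ²)·(V₁ − H) + (S₂/σₙ²)·conj(F)·(V₂ − F·H) − H/σ_H² = 0 and conj(H)·(V₂ − F·H) = 0 is exactly { (c·V₁, V₂/(c·V₁)), (0, −conj(V₁)/(α·conj(V₂))) }. -/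
/-- Single-packet case (`L = 1`).  For nonzero scalars `V₁, V₂`,
the set of pairs `(H, F)` satisfying the stationarity system of the
single-packet hybrid log-likelihood is exactly
`{(c·V₁, V₂/(c·V₁)), (0, −conj(V₁)/(α·conj(V₂)))}`. -/
theorem single_packet_stationary_points (V1 V2 : ℂ) (hV1 : V1 ≠ 0) (hV2 : V2 ≠ 0)
    (S1 S2 σn2 σH2 : ℝ) (hS1 : 0 < S1) (hS2 : 0 < S2) (hσn2 : 0 < σn2) (hσH2 : 0 < σH2)
    (α c : ℝ) (hα : α = S2 / S1) (hc : c = S1 * σH2 / (S1 * σH2 + σn2)) :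
    {p : ℂ × ℂ |
        ((S1 / σn2 : ℝ) : ℂ) * (V1 - p.1)
            + ((S2 / σn2 : ℝ) : ℂ) * (starRingEnd ℂ) p.2 * (V2 - p.2 * p.1)
            - p.1 / (σH2 : ℂ) = 0
          ∧ (starRingEnd ℂ) p.1 * (V2 - p.2 * p.1) = 0}
      = {((c : ℂ) * V1, V2 / ((c : ℂ) * V1)),
         (0, -(starRingEnd ℂ) V1 / ((α : ℂ) * (starRingEnd ℂ) V2))} := by
  have hS1' : (S1 : ℂ) ≠ 0 := by exact_mod_cast hS1.ne'
  have hS2' : (S2 : ℂ) ≠ 0 := by exact_mod_cast hS2.ne'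
  have hσn2' : (σn2 : ℂ) ≠ 0 := by exact_mod_cast hσn2.ne'
  have hσH2' : (σH2 : ℂ) ≠ 0 := by exact_mod_cast hσH2.ne'
  have hden : (S1 : ℂ) * σH2 + σn2 ≠ 0 := by
    exact_mod_cast (add_pos (mul_pos hS1 hσH2) hσn2).ne'
  have hcC : (c : ℂ) = S1 * σH2 / (S1 * σH2 + σn2) := by rw [hc]; push_cast; rfl
  have hαC : (α : ℂ) = S2 / S1 := by rw [hα]; push_cast; rfl
  have hc0 : (c : ℂ) ≠ 0 := by
    rw [hcC]; exact div_ne_zero (mul_ne_zero hS1' hσH2') hden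
  have hV2' : (starRingEnd ℂ) V2 ≠ 0 := (map_ne_zero _).mpr hV2
  ext ⟨H, F⟩
  simp only [Set.mem_ofPred_eq, Set.mem_insert_iff, Set.mem_singleton_iff, Prod.mk.injEq,
    Complex.ofReal_div]
  constructor
  · rintro ⟨hgradH, hgradF⟩
    rcases mul_eq_zero.mp hgradF with hH | hres
    · right
      have hH0 : H = 0 := (map_eq_zero _).mp hH
      subst hH0
      refine ⟨rfl, ?_⟩
      have hF : (S1 : ℂ) * V1 + S2 * (starRingEnd ℂ) F * V2 = 0 := by
        simp only [mul_zero, sub_zero, zero_div] at hgradH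
        field_simp at hgradH
        linear_combination hgradH
      have hF' := congrArg (starRingEnd ℂ) hF
      simp only [map_add, map_mul, Complex.conj_ofReal, Complex.conj_conj, map_zero] at hF'
      rw [hαC, eq_div_iff (mul_ne_zero (div_ne_zero hS2' hS1') hV2')]
      field_simp
      linear_combination hF'
    · left
      have hHc : H = c * V1 := by
        rw [hres] at hgradH
        rw [hcC, div_mul_eq_mul_div, eq_div_iff hden]
        field_simp at hgradH
        linear_combination -hgradH
      refine ⟨hHc, ?_⟩
      rw [eq_div_iff (mul_ne_zero hc0 hV1), ← hHc]
      linear_combination -hres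
  · rintro (⟨rfl, rfl⟩ | ⟨rfl, rfl⟩)
    · rw [div_mul_cancel₀ V2 (mul_ne_zero hc0 hV1), sub_self, mul_zero, mul_zero, hcC]
      refine ⟨?_, rfl⟩
      field_simp
      ring
    · simp only [map_div₀, map_neg, map_mul, Complex.conj_ofReal, Complex.conj_conj, map_zero,
        zero_mul, and_true, hαC]
      field_simp
      ring
end

section
/- (Single-packet global maximality.) Let V₁, V₂ ∈ ℂ with V₁ ≠ 0, let S₁, S₂, σₙ², σ_H² be positive reals, and c = S₁σ_H²/(S₁σ_H² + σₙ²). Define f(H, F) = −(S₁/σₙ²)·|V₁ − H|² − (S₂/σₙ²)·|V₂ − F·H|² − |H|²/σ_H² for (H, F) ∈ ℂ × ℂ. Then for all (H, F) ∈ ℂ × ℂ, f(H, F) ≤ −(S₁/σₙ²)·|V₁|²·(1 − c), with equality at (H, F) = (c·V₁, V₂/(c·V₁)). Hence (c·V₁, V₂/(c·V₁)) is a global maximizer of the single-packet hybrid log-likelihood, i.e., the joint MAP/ML estimate. -/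
/-- Completing the square in a sum of two weighted squared distances in `ℂ`. -/
theorem Complex.normSq_complete_square (V H : ℂ) {a b c : ℝ} (h : a = c * (a + b)) :
    a * Complex.normSq (V - H) + b * Complex.normSq H
      = a * Complex.normSq V * (1 - c) + (a + b) * Complex.normSq (H - (c : ℂ) * V) := by
  simp only [Complex.normSq_apply, Complex.sub_re, Complex.sub_im, Complex.re_ofReal_mul,
    Complex.im_ofReal_mul]
  linear_combination
    (c * (V.re * V.re + V.im * V.im) - 2 * (H.re * V.re + H.im * V.im)) * h

/-- Single-packet global maximality.  The single-packet hybrid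
log-likelihood `f(H,F) = −(S₁/σₙ²)|V₁−H|² − (S₂/σₙ²)|V₂−FH|² − |H|²/σ_H²`
satisfies `f(H,F) ≤ −(S₁/σₙ²)|V₁|²(1−c)` for all `(H,F)`, with equality at
`(H,F) = (c·V₁, V₂/(c·V₁))`; hence this point is the joint MAP/ML estimate. -/
theorem single_packet_global_max (V1 V2 : ℂ) (hV1 : V1 ≠ 0)
    (S1 S2 σn2 σH2 : ℝ) (hS1 : 0 < S1) (hS2 : 0 < S2) (hσn2 : 0 < σn2) (hσH2 : 0 < σH2)
    (c : ℝ) (hc : c = S1 * σH2 / (S1 * σH2 + σn2))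
    (f : ℂ → ℂ → ℝ)
    (hf : ∀ H F : ℂ, f H F = -(S1 / σn2) * Complex.normSq (V1 - H)
        - (S2 / σn2) * Complex.normSq (V2 - F * H) - Complex.normSq H / σH2) :
    (∀ H F : ℂ, f H F ≤ -(S1 / σn2) * Complex.normSq V1 * (1 - c))
      ∧ f ((c : ℂ) * V1) (V2 / ((c : ℂ) * V1))
          = -(S1 / σn2) * Complex.normSq V1 * (1 - c) := by
  have hden : 0 < S1 * σH2 + σn2 := by positivity
  have hc0 : 0 < c := by rw [hc]; positivity
  have hbalance : S1 / σn2 = c * (S1 / σn2 + 1 / σH2) := by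
    rw [hc]
    field_simp
  have key : ∀ H F : ℂ, f H F = -(S1 / σn2) * Complex.normSq V1 * (1 - c)
      - (S1 / σn2 + 1 / σH2) * Complex.normSq (H - (c : ℂ) * V1)
      - (S2 / σn2) * Complex.normSq (V2 - F * H) := by
    intro H F
    rw [hf]
    linear_combination -Complex.normSq_complete_square V1 H hbalance
  refine ⟨fun H F => ?_, ?_⟩
  · have h₁ : 0 ≤ (S1 / σn2 + 1 / σH2) * Complex.normSq (H - (c : ℂ) * V1) :=
      mul_nonneg (by positivity) (Complex.normSq_nonneg _)
    have h₂ : 0 ≤ (S2 / σn2) * Complex.normSq (V2 - F * H) :=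
      mul_nonneg (by positivity) (Complex.normSq_nonneg _)
    rw [key]
    linarith
  · have hne : (c : ℂ) * V1 ≠ 0 := mul_ne_zero (Complex.ofReal_ne_zero.mpr hc0.ne') hV1
    rw [key, div_mul_cancel₀ _ hne]
    simp
end

section
/- (Consistency of the modified estimator F̂_C.) Let S₁, S₂, σₙ², σ_H² be positive reals with σₙ² < S₁·σ_H², set α = S₂/S₁, c = S₁σ_H²/(S₁σ_H² + σₙ²), d = 1 − (σₙ²/(S₁σ_H²))², and let F ∈ ℂ with F ≠ 0. Define the limiting correlations p₁₁ = σ_H² + σₙ²/S₁, p₂₁ = σ_H²·conj(F), p₂₂ = |F|²·σ_H² + σₙ²/S₂. Then (α·p₂₂ − c·p₁₁)² + 4·α·c·d·|p₂₁|² = (σ_H²·(α|F|² + c·d))², the quantity α|F|² + c·d is positive, and (α·p₂₂ − c·p₁₁ + σ_H²·(α|F|² + c·d)) / (2·α·p₂₁) = F. That is, evaluating F̂_C = (αP₂₂ − cP₁₁ + √((αP₂₂ − cP₁₁)² + 4αcd|P₂₁|²))/(2αP₂₁) at the limiting correlations recovers the true F. -/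
/-- Consistency of the modified estimator `F̂_C`.  At the limiting
correlations, the discriminant with the completing factor `d` is the square of
`σ_H²(α|F|² + cd)`, this quantity is positive, and the positive root
`(αp₂₂ − cp₁₁ + σ_H²(α|F|² + cd))/(2αp₂₁)` equals the true `F`. -/
theorem modified_estimator_consistent (S1 S2 σn2 σH2 : ℝ)
    (hS1 : 0 < S1) (hS2 : 0 < S2) (hσn2 : 0 < σn2) (hσH2 : 0 < σH2)
    (hlt : σn2 < S1 * σH2)
    (α c d : ℝ) (hα : α = S2 / S1) (hc : c = S1 * σH2 / (S1 * σH2 + σn2))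
    (hd : d = 1 - (σn2 / (S1 * σH2)) ^ 2)
    (F : ℂ) (hF : F ≠ 0)
    (p11 : ℝ) (h11 : p11 = σH2 + σn2 / S1)
    (p21 : ℂ) (h21 : p21 = (σH2 : ℂ) * (starRingEnd ℂ) F)
    (p22 : ℝ) (h22 : p22 = Complex.normSq F * σH2 + σn2 / S2) :
    (α * p22 - c * p11) ^ 2 + 4 * α * c * d * Complex.normSq p21
        = (σH2 * (α * Complex.normSq F + c * d)) ^ 2
      ∧ 0 < α * Complex.normSq F + c * d
      ∧ ((α * p22 - c * p11 + σH2 * (α * Complex.normSq F + c * d) : ℝ) : ℂ)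
            / (2 * (α : ℂ) * p21) = F := by
  have hα0 : 0 < α := by rw [hα]; positivity
  have hN : 0 < Complex.normSq F := Complex.normSq_pos.mpr hF
  have hcd : c * d = 1 - σn2 / (S1 * σH2) := by
    rw [hc, hd]
    have : S1 * σH2 + σn2 ≠ 0 := by positivity
    field_simp
    ring
  have hcd0 : 0 < c * d := by
    rw [hcd, sub_pos, div_lt_one (by positivity)]
    exact hlt
  have hdiff : α * p22 - c * p11 = σH2 * (α * Complex.normSq F - c * d) := by
    rw [hcd, hα, hc, h11, h22]
    have : S1 * σH2 + σn2 ≠ 0 := by positivity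
    field_simp
    ring
  have hnorm : Complex.normSq p21 = σH2 ^ 2 * Complex.normSq F := by
    rw [h21, Complex.normSq_mul, Complex.normSq_conj, Complex.normSq_ofReal]
    ring
  refine ⟨?_, by positivity, ?_⟩
  · rw [hdiff, hnorm]
    ring
  · have hnum : α * p22 - c * p11 + σH2 * (α * Complex.normSq F + c * d)
        = 2 * α * σH2 * Complex.normSq F := by
      rw [hdiff]
      ring
    have hαC : (α : ℂ) ≠ 0 := Complex.ofReal_ne_zero.mpr hα0.ne'
    have hσC : (σH2 : ℂ) ≠ 0 := Complex.ofReal_ne_zero.mpr hσH2.ne'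
    have hFC : (starRingEnd ℂ) F ≠ 0 := (map_ne_zero _).mpr hF
    rw [hnum, h21, div_eq_iff (by simp [hαC, hσC, hF])]
    push_cast
    rw [Complex.normSq_eq_conj_mul_self]
    ring
end
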